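/- Let α, β > −1 and let W ≥ 1 and s ≥ 0 be fixed. Then there exists a constant C > 0 such that for all θ, φ ∈ (0,π) with θ ≠ φ: ( ∫_0^π (Υ_{W,s}^{α,β}(t,θ,φ))² t^{W−1} dt )^{1/2} ≤ C · |θ−φ|^{−s} / μ_{α,β}(B(θ,|θ−φ|)). -/

import Mathlib

open Real Set MeasureTheory

/-- `q(θ,φ,u,v) = 1 − u sin(θ/2) sin(φ/2) − v cos(θ/2) cos(φ/2)`. -/
noncomputable def q (θ φ u v : ℝ) : ℝ :=
  1 - u * Real.sin (θ / 2) * Real.sin (φ / 2) - v * Real.cos (θ / 2) * Real.cos (φ / 2)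

/-- The measure `Π_a` on `[−1,1]`: for `a > −1/2` it has density
`Γ(a+1)/(√π Γ(a+1/2)) (1−u²)^{a−1/2}`, and `Π_{−1/2}` is `(δ_{−1}+δ_1)/2`. -/
noncomputable def jacobiPi (a : ℝ) : Measure ℝ :=
  if a = -(1 / 2) then
    (2 : ENNReal)⁻¹ • (Measure.dirac (-1) + Measure.dirac 1)
  else
    (volume.restrict (Icc (-1 : ℝ) 1)).withDensity
      (fun u => ENNReal.ofReal
        (Real.Gamma (a + 1) / (Real.sqrt π * Real.Gamma (a + 1 / 2)) * (1 - u ^ 2) ^ (a - 1 / 2)))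

/-- `Π_a^K`: equals `Π_{−1/2}` if `K = 0` and `Π_{a+1}` if `K = 1`. -/
noncomputable def jacobiPiK (a : ℝ) (K : ℕ) : Measure ℝ :=
  if K = 0 then jacobiPi (-(1 / 2)) else jacobiPi (a + 1)

/-- The function `Υ_{W,s}^{α,β}(t,θ,φ)`, defined by cases according to the
positions of `α, β` relative to `−1/2`. -/
noncomputable def Ups (α β W s t θ φ : ℝ) : ℝ :=
  if -(1 / 2) ≤ α then
    if -(1 / 2) ≤ β then
      ∫ u, ∫ v, (t ^ 2 + q θ φ u v) ^ (-(α + β + 3 / 2 + W / 4 + s / 2))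
        ∂(jacobiPi β) ∂(jacobiPi α)
    else
      1 + ∑ R ∈ Finset.range 2, ∑ r ∈ Finset.range 3,
        (Real.cos (θ / 2) + Real.cos (φ / 2)) ^ (R * r) *
        ∫ u, ∫ v,
          (t ^ 2 + q θ φ u v) ^ (-(α + β + 3 / 2 + W / 4 + ((R * r : ℕ) : ℝ) / 2 + s / 2))
          ∂(jacobiPiK β R) ∂(jacobiPi α)
  else
    if -(1 / 2) ≤ β then
      1 + ∑ K ∈ Finset.range 2, ∑ k ∈ Finset.range 3,
        (Real.sin (θ / 2) + Real.sin (φ / 2)) ^ (K * k) *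
        ∫ u, ∫ v,
          (t ^ 2 + q θ φ u v) ^ (-(α + β + 3 / 2 + W / 4 + ((K * k : ℕ) : ℝ) / 2 + s / 2))
          ∂(jacobiPi β) ∂(jacobiPiK α K)
    else
      1 + ∑ K ∈ Finset.range 2, ∑ R ∈ Finset.range 2, ∑ k ∈ Finset.range 3, ∑ r ∈ Finset.range 3,
        (Real.sin (θ / 2) + Real.sin (φ / 2)) ^ (K * k) *
        (Real.cos (θ / 2) + Real.cos (φ / 2)) ^ (R * r) *
        ∫ u, ∫ v,
          (t ^ 2 + q θ φ u v) ^
            (-(α + β + 3 / 2 + W / 4 + ((K * k : ℕ) : ℝ) / 2 + ((R * r : ℕ) : ℝ) / 2 + s / 2))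
          ∂(jacobiPiK β R) ∂(jacobiPiK α K)

/-- The Jacobi measure `μ_{α,β}` on `(0,π)` with density
`(sin(θ/2))^{2α+1} (cos(θ/2))^{2β+1}`. -/
noncomputable def jacobiMeasure (α β : ℝ) : Measure ℝ :=
  (volume.restrict (Ioo 0 π)).withDensity
    (fun θ => ENNReal.ofReal ((Real.sin (θ / 2)) ^ (2 * α + 1) * (Real.cos (θ / 2)) ^ (2 * β + 1)))

/-- The ball `B(θ,r) = (θ−r, θ+r) ∩ (0,π)`. -/
def jacobiBall (θ r : ℝ) : Set ℝ := Ioo (θ - r) (θ + r) ∩ Ioo 0 π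

/-- The smallest value `1 - cos ((θ - φ) / 2)` of `q θ φ` on the square `[-1, 1]²`. -/
noncomputable def qMin (θ φ : ℝ) : ℝ := q θ φ 1 1

/-- `sin (θ / 2) + sin (φ / 2)`. -/
noncomputable def sinSum (θ φ : ℝ) : ℝ := Real.sin (θ / 2) + Real.sin (φ / 2)

/-- `cos (θ / 2) + cos (φ / 2)`. -/
noncomputable def cosSum (θ φ : ℝ) : ℝ := Real.cos (θ / 2) + Real.cos (φ / 2)

lemma sin_half_pos {θ : ℝ} (hθ : θ ∈ Ioo (0 : ℝ) π) : 0 < Real.sin (θ / 2) :=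
  Real.sin_pos_of_pos_of_lt_pi (by linarith [hθ.1]) (by linarith [hθ.1, hθ.2])

lemma cos_half_pos {θ : ℝ} (hθ : θ ∈ Ioo (0 : ℝ) π) : 0 < Real.cos (θ / 2) :=
  Real.cos_pos_of_mem_Ioo ⟨by linarith [hθ.1, Real.pi_pos], by linarith [hθ.2]⟩

lemma pi_sub_mem_Ioo {θ : ℝ} (hθ : θ ∈ Ioo (0 : ℝ) π) : π - θ ∈ Ioo (0 : ℝ) π :=
  ⟨by linarith [hθ.2], by linarith [hθ.1]⟩

lemma sin_half_pi_sub (θ : ℝ) : Real.sin ((π - θ) / 2) = Real.cos (θ / 2) := by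
  rw [← Real.sin_pi_div_two_sub]; congr 1; ring

lemma cos_half_pi_sub (θ : ℝ) : Real.cos ((π - θ) / 2) = Real.sin (θ / 2) := by
  rw [← Real.cos_pi_div_two_sub]; congr 1; ring

lemma sinSum_pi_sub (θ φ : ℝ) : sinSum (π - θ) (π - φ) = cosSum θ φ := by
  simp only [sinSum, cosSum, sin_half_pi_sub]

lemma cosSum_pi_sub (θ φ : ℝ) : cosSum (π - θ) (π - φ) = sinSum θ φ := by
  simp only [sinSum, cosSum, cos_half_pi_sub]

lemma qMin_pi_sub (θ φ : ℝ) : qMin (π - θ) (π - φ) = qMin θ φ := by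
  simp only [qMin, q, sin_half_pi_sub, cos_half_pi_sub]; ring

lemma sinSum_pos {θ φ : ℝ} (hθ : θ ∈ Ioo (0 : ℝ) π) (hφ : φ ∈ Ioo (0 : ℝ) π) :
    0 < sinSum θ φ := add_pos (sin_half_pos hθ) (sin_half_pos hφ)

lemma cosSum_pos {θ φ : ℝ} (hθ : θ ∈ Ioo (0 : ℝ) π) (hφ : φ ∈ Ioo (0 : ℝ) π) :
    0 < cosSum θ φ := add_pos (cos_half_pos hθ) (cos_half_pos hφ)

lemma sinSum_le_two (θ φ : ℝ) : sinSum θ φ ≤ 2 := by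
  unfold sinSum; linarith [Real.sin_le_one (θ / 2), Real.sin_le_one (φ / 2)]

lemma cosSum_le_two (θ φ : ℝ) : cosSum θ φ ≤ 2 := by
  unfold cosSum; linarith [Real.cos_le_one (θ / 2), Real.cos_le_one (φ / 2)]

lemma qMin_eq (θ φ : ℝ) : qMin θ φ = 1 - Real.cos (θ / 2 - φ / 2) := by
  rw [qMin, q, Real.cos_sub]; ring

lemma sq_sub_le_qMin {θ φ : ℝ} (hθ : θ ∈ Ioo (0 : ℝ) π) (hφ : φ ∈ Ioo (0 : ℝ) π) :
    1 / (2 * π ^ 2) * |θ - φ| ^ 2 ≤ qMin θ φ := by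
  have h : |θ / 2 - φ / 2| ≤ π := by
    rw [abs_le]; constructor <;> linarith [hθ.1, hθ.2, hφ.1, hφ.2, Real.pi_pos]
  have := Real.cos_le_one_sub_mul_cos_sq h
  rw [qMin_eq, sq_abs]
  have e : 1 / (2 * π ^ 2) * (θ - φ) ^ 2 = 2 / π ^ 2 * (θ / 2 - φ / 2) ^ 2 := by
    field_simp
  linarith

lemma qMin_pos {θ φ : ℝ} (hθ : θ ∈ Ioo (0 : ℝ) π) (hφ : φ ∈ Ioo (0 : ℝ) π) (hne : θ ≠ φ) :
    0 < qMin θ φ := by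
  have h := sq_sub_le_qMin hθ hφ
  have : 0 < |θ - φ| := abs_pos.2 (sub_ne_zero.2 hne)
  have := Real.pi_pos
  exact lt_of_lt_of_le (by positivity) h

lemma qMin_le_two (θ φ : ℝ) : qMin θ φ ≤ 2 := by
  rw [qMin_eq]; linarith [Real.neg_one_le_cos (θ / 2 - φ / 2)]

lemma qMin_le_sinSum_sq {θ φ : ℝ} (hθ : θ ∈ Ioo (0 : ℝ) π) (hφ : φ ∈ Ioo (0 : ℝ) π) :
    qMin θ φ ≤ sinSum θ φ ^ 2 := by
  have h0 : 0 ≤ Real.cos (θ / 2 - φ / 2) := Real.cos_nonneg_of_mem_Icc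
    ⟨by linarith [hθ.1, hφ.2], by linarith [hθ.2, hφ.1]⟩
  have h1 : qMin θ φ ≤ Real.sin (θ / 2 - φ / 2) ^ 2 := by
    rw [qMin_eq]
    nlinarith [Real.sin_sq_add_cos_sq (θ / 2 - φ / 2), Real.cos_le_one (θ / 2 - φ / 2)]
  refine h1.trans (sq_le_sq.2 ?_)
  rw [abs_of_pos (sinSum_pos hθ hφ), Real.sin_sub, sinSum, abs_le]
  have a1 := sin_half_pos hθ
  have a2 := sin_half_pos hφ
  have a3 := cos_half_pos hθ
  have a4 := cos_half_pos hφ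
  constructor <;> nlinarith [Real.cos_le_one (θ / 2), Real.cos_le_one (φ / 2)]

lemma qMin_le_cosSum_sq {θ φ : ℝ} (hθ : θ ∈ Ioo (0 : ℝ) π) (hφ : φ ∈ Ioo (0 : ℝ) π) :
    qMin θ φ ≤ cosSum θ φ ^ 2 := by
  rw [← qMin_pi_sub, ← sinSum_pi_sub]
  exact qMin_le_sinSum_sq (pi_sub_mem_Ioo hθ) (pi_sub_mem_Ioo hφ)

lemma sinSum_sq_le {θ φ : ℝ} (hθ : θ ∈ Ioo (0 : ℝ) π) (hφ : φ ∈ Ioo (0 : ℝ) π) :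
    1 / 8 * sinSum θ φ ^ 2 ≤ qMin θ φ + Real.sin (θ / 2) * Real.sin (φ / 2) := by
  have a1 := sin_half_pos hθ
  have a2 := sin_half_pos hφ
  have a3 := cos_half_pos hθ
  have a4 := cos_half_pos hφ
  simp only [sinSum, qMin, q]
  nlinarith [Real.cos_le_one (θ / 2), Real.cos_le_one (φ / 2), Real.sin_sq_add_cos_sq (θ / 2),
    Real.sin_sq_add_cos_sq (φ / 2), sq_nonneg (Real.sin (θ / 2) - Real.sin (φ / 2)),
    mul_nonneg (sub_nonneg.2 (Real.cos_le_one (θ / 2))) a4.le,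
    mul_nonneg (sub_nonneg.2 (Real.cos_le_one (φ / 2))) a3.le]

lemma cosSum_sq_le {θ φ : ℝ} (hθ : θ ∈ Ioo (0 : ℝ) π) (hφ : φ ∈ Ioo (0 : ℝ) π) :
    1 / 8 * cosSum θ φ ^ 2 ≤ qMin θ φ + Real.cos (θ / 2) * Real.cos (φ / 2) := by
  have h := sinSum_sq_le (pi_sub_mem_Ioo hθ) (pi_sub_mem_Ioo hφ)
  rwa [qMin_pi_sub, sinSum_pi_sub, sin_half_pi_sub, sin_half_pi_sub] at h

lemma one_le_sinSum_add_cosSum {θ φ : ℝ} (hθ : θ ∈ Ioo (0 : ℝ) π) (hφ : φ ∈ Ioo (0 : ℝ) π) :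
    1 ≤ sinSum θ φ + cosSum θ φ := by
  have a1 := sin_half_pos hθ
  have a2 := sin_half_pos hφ
  have a3 := cos_half_pos hθ
  have a4 := cos_half_pos hφ
  simp only [sinSum, cosSum]
  nlinarith [Real.sin_le_one (θ / 2), Real.cos_le_one (θ / 2), Real.sin_sq_add_cos_sq (θ / 2)]

lemma sqrt_qMin_le_sinSum_mul_cosSum {θ φ : ℝ} (hθ : θ ∈ Ioo (0 : ℝ) π)
    (hφ : φ ∈ Ioo (0 : ℝ) π) : √(qMin θ φ) ≤ 2 * (sinSum θ φ * cosSum θ φ) := by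
  have h1 := sinSum_pos hθ hφ
  have h2 := cosSum_pos hθ hφ
  have h3 := one_le_sinSum_add_cosSum hθ hφ
  have h4 : √(qMin θ φ) ≤ sinSum θ φ := Real.sqrt_le_left h1.le |>.2 (qMin_le_sinSum_sq hθ hφ)
  have h5 : √(qMin θ φ) ≤ cosSum θ φ := Real.sqrt_le_left h2.le |>.2 (qMin_le_cosSum_sq hθ hφ)
  rcases le_total (sinSum θ φ) (cosSum θ φ) with h | h <;> nlinarith

lemma q_eq (θ φ u v : ℝ) :
    q θ φ u v = qMin θ φ + Real.sin (θ / 2) * Real.sin (φ / 2) * (1 - u)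
      + Real.cos (θ / 2) * Real.cos (φ / 2) * (1 - v) := by
  simp only [qMin, q]; ring

lemma rpow_le_mul_rpow {c d x y : ℝ} (a : ℝ) (hc : 0 < c) (hx : 0 < x) (h1 : c * x ≤ y)
    (h2 : y ≤ d * x) : y ^ a ≤ (c ^ a + d ^ a) * x ^ a := by
  have hcx : 0 < c * x := by positivity
  have hy : 0 < y := hcx.trans_le h1
  have hd : 0 < d := pos_of_mul_pos_left (hy.trans_le h2) hx.le
  rw [add_mul, ← Real.mul_rpow hc.le hx.le, ← Real.mul_rpow hd.le hx.le]
  rcases le_total 0 a with ha | ha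
  · have := Real.rpow_le_rpow hy.le h2 ha
    have := Real.rpow_nonneg hcx.le a
    linarith
  · have := Real.rpow_le_rpow_of_nonpos hcx h1 ha
    have := Real.rpow_nonneg (hcx.le.trans (h1.trans h2)) a
    linarith

lemma setIntegral_le_of_two_powers {p σ x₀ M N : ℝ} (hp : 0 < p) (hσ : 0 < σ) (hx₀ : 0 < x₀)
    (hM : 0 ≤ M) (hN : 0 ≤ N) {E : Set ℝ} (hE : MeasurableSet E) (hE0 : E ⊆ Ioi 0) {f : ℝ → ℝ}
    (h0 : ∀ x ∈ E, 0 ≤ f x) (h1 : ∀ x ∈ E, x ≤ x₀ → f x ≤ M * x ^ (p - 1))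
    (h2 : ∀ x ∈ E, x₀ < x → f x ≤ N * x ^ (-σ - 1)) :
    ∫ x in E, f x ≤ M * (x₀ ^ p / p) + N * (x₀ ^ (-σ) / σ) := by
  set D : ℝ → ℝ := fun x => if x ≤ x₀ then M * x ^ (p - 1) else N * x ^ (-σ - 1) with hD
  have e1 : EqOn D (fun x => M * x ^ (p - 1)) (Ioc 0 x₀) := fun x hx => if_pos hx.2
  have e2 : EqOn D (fun x => N * x ^ (-σ - 1)) (Ioi x₀) := fun x hx => if_neg (not_le.2 hx)
  have i1 : IntegrableOn D (Ioc 0 x₀) := by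
    refine IntegrableOn.congr_fun ?_ e1.symm measurableSet_Ioc
    rw [← intervalIntegrable_iff_integrableOn_Ioc_of_le hx₀.le]
    exact (intervalIntegral.intervalIntegrable_rpow' (by linarith)).const_mul M
  have i2 : IntegrableOn D (Ioi x₀) := by
    refine IntegrableOn.congr_fun ?_ e2.symm measurableSet_Ioi
    exact (integrableOn_Ioi_rpow_of_lt (by linarith) hx₀).const_mul N
  have hu : Ioi (0 : ℝ) = Ioc 0 x₀ ∪ Ioi x₀ := (Ioc_union_Ioi_eq_Ioi hx₀.le).symm
  have i : IntegrableOn D (Ioi 0) := by rw [hu]; exact i1.union i2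
  have hDnn : ∀ x ∈ Ioi (0 : ℝ), 0 ≤ D x := by
    intro x hx
    have hx : 0 < x := hx
    simp only [hD]; split_ifs <;> positivity
  calc ∫ x in E, f x ≤ ∫ x in E, D x := by
        refine integral_mono_of_nonneg ?_ (i.mono_set hE0) ?_
        · exact (ae_restrict_iff' hE).2 (.of_forall h0)
        · refine (ae_restrict_iff' hE).2 (.of_forall fun x hx => ?_)
          simp only [hD]; split_ifs with h
          · exact h1 x hx h
          · exact h2 x hx (not_le.1 h)
    _ ≤ ∫ x in Ioi 0, D x :=
        setIntegral_mono_set i ((ae_restrict_iff' measurableSet_Ioi).2 (.of_forall hDnn))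
          hE0.eventuallyLE
    _ = (∫ x in Ioc 0 x₀, D x) + ∫ x in Ioi x₀, D x := by
        rw [hu, setIntegral_union (Ioc_disjoint_Ioi le_rfl) measurableSet_Ioi i1 i2]
    _ = M * (x₀ ^ p / p) + N * (x₀ ^ (-σ) / σ) := by
        rw [setIntegral_congr_fun measurableSet_Ioc e1, setIntegral_congr_fun measurableSet_Ioi e2,
          integral_const_mul, integral_const_mul, integral_Ioi_rpow_of_lt (by linarith) hx₀,
          ← intervalIntegral.integral_of_le hx₀.le, integral_rpow (Or.inl (by linarith))]
        simp only [sub_add_cancel]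
        rw [Real.zero_rpow hp.ne', sub_zero, neg_div_neg_eq]

lemma integral_mul_rpow_le {p l : ℝ} (hp : 0 < p) (hl : p < l) {A B : ℝ} (hA : 0 < A)
    (hB : 0 ≤ B) :
    ∫ x in (0 : ℝ)..1, x ^ (p - 1) * (A + B * x) ^ (-l)
      ≤ (1 / p + 1 / (l - p)) * A ^ (p - l) * (A + B) ^ (-p) := by
  have hAB : 0 < A + B := by linarith
  have hx₀ : 0 < A / (A + B) := by positivity
  rw [intervalIntegral.integral_of_le zero_le_one]
  refine (setIntegral_le_of_two_powers (M := A ^ (-l)) (N := (A + B) ^ (-l)) hp (sub_pos.2 hl) hx₀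
    (by positivity) (by positivity) measurableSet_Ioc (fun x hx => hx.1) ?_ ?_ ?_).trans_eq ?_
  · intro x hx
    have := hx.1
    positivity
  · intro x hx _
    have := hx.1
    rw [mul_comm]
    gcongr ?_ * _
    exact Real.rpow_le_rpow_of_nonpos hA (by nlinarith) (by linarith)
  · intro x hx _
    have hx0 := hx.1
    have e : (A + B) ^ (-l) * x ^ (-(l - p) - 1) = x ^ (p - 1) * ((A + B) * x) ^ (-l) := by
      rw [Real.mul_rpow hAB.le hx0.le, mul_left_comm, ← Real.rpow_add hx0]
      congr 2; ring
    rw [e]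
    gcongr _ * ?_
    exact Real.rpow_le_rpow_of_nonpos (by positivity) (by nlinarith [hx.2]) (by linarith)
  · have e1 : A ^ (-l) * (A / (A + B)) ^ p = A ^ (p - l) * (A + B) ^ (-p) := by
      rw [Real.div_rpow hA.le hAB.le, Real.rpow_neg hAB.le, Real.rpow_sub hA, Real.rpow_neg hA.le]
      ring
    have e2 : (A + B) ^ (-l) * (A / (A + B)) ^ (-(l - p)) = A ^ (p - l) * (A + B) ^ (-p) := by
      rw [neg_sub, Real.div_rpow hA.le hAB.le, mul_div_assoc', mul_comm, mul_div_assoc,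
        ← Real.rpow_sub hAB]
      congr 2; ring
    rw [mul_div_assoc', mul_div_assoc', e1, e2]; ring

lemma integral_add_sq_rpow_le {W e : ℝ} (hW : 0 < W) (he : 0 < e) {A R : ℝ} (hA : 0 < A) :
    ∫ t in Ioo (0 : ℝ) R, (A + t ^ 2) ^ (-(2 * e + W / 2)) * t ^ (W - 1)
      ≤ (1 / W + 1 / (4 * e)) * A ^ (-(2 * e)) := by
  have hx₀ : 0 < A ^ (1 / 2 : ℝ) := by positivity
  refine (setIntegral_le_of_two_powers (M := A ^ (-(2 * e + W / 2))) (N := 1) (σ := 4 * e) hW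
    (by positivity) hx₀ (by positivity) (by positivity) measurableSet_Ioo (fun x hx => hx.1)
    ?_ ?_ ?_).trans_eq ?_
  · intro x hx
    have := hx.1
    positivity
  · intro x hx _
    have := hx.1
    gcongr ?_ * _
    exact Real.rpow_le_rpow_of_nonpos hA (by nlinarith) (by linarith)
  · intro x hx _
    have hx0 := hx.1
    have e : 1 * x ^ (-(4 * e) - 1) = (x ^ 2) ^ (-(2 * e + W / 2)) * x ^ (W - 1) := by
      rw [← Real.rpow_natCast, ← Real.rpow_mul hx0.le, ← Real.rpow_add hx0, one_mul]
      congr 1; push_cast; ring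
    rw [e]
    gcongr ?_ * _
    exact Real.rpow_le_rpow_of_nonpos (by positivity) (by nlinarith) (by linarith)
  · rw [← Real.rpow_mul hA.le, ← Real.rpow_mul hA.le, mul_div_assoc', ← Real.rpow_add hA]
    ring_nf

lemma integral_comp_one_sub_abs {H : ℝ → ℝ} (hH : IntervalIntegrable H volume 0 1) :
    IntervalIntegrable (fun u => H (1 - |u|)) volume (-1) 1 ∧
      ∫ u in (-1 : ℝ)..1, H (1 - |u|) = 2 * ∫ x in (0 : ℝ)..1, H x := by
  have i1 : IntervalIntegrable (fun u => H (1 - |u|)) volume 0 1 := by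
    have := (hH.comp_sub_left 1).symm
    simp only [sub_zero, sub_self] at this
    refine this.congr fun x hx => ?_
    rw [uIoc_of_le zero_le_one] at hx
    simp only [abs_of_pos hx.1]
  have i2 : IntervalIntegrable (fun u => H (1 - |u|)) volume (-1) 0 := by
    have := hH.comp_add_right 1
    simp only [zero_sub, sub_self] at this
    refine this.congr fun x hx => ?_
    rw [uIoc_of_le (by norm_num)] at hx
    simp only [abs_of_nonpos hx.2]
    congr 1; ring
  refine ⟨i2.trans i1, ?_⟩
  rw [← intervalIntegral.integral_add_adjacent_intervals i2 i1]
  have e1 : ∫ u in (0 : ℝ)..1, H (1 - |u|) = ∫ x in (0 : ℝ)..1, H x := by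
    have := intervalIntegral.integral_comp_sub_left (a := 0) (b := 1) H 1
    simp only [sub_zero, sub_self] at this
    rw [← this]
    refine intervalIntegral.integral_congr fun x hx => ?_
    rw [uIcc_of_le zero_le_one] at hx
    simp only [abs_of_nonneg hx.1]
  have e2 : ∫ u in (-1 : ℝ)..0, H (1 - |u|) = ∫ x in (0 : ℝ)..1, H x := by
    have := intervalIntegral.integral_comp_add_right (a := -1) (b := 0) H 1
    simp only [zero_add, neg_add_cancel] at this
    rw [← this]
    refine intervalIntegral.integral_congr fun x hx => ?_
    rw [uIcc_of_le (by norm_num)] at hx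
    simp only [abs_of_nonpos hx.2]
    congr 1; ring
  rw [e1, e2]; ring

/-- A finite measure on `[-1, 1]` all of whose kernel integrals `∫ (A + B (1 - u)) ^ (-l)`
gain the power `((A + B) / A) ^ (-p)` over the trivial bound `A ^ (-l)`. -/
structure KernelBound (ν : Measure ℝ) (p : ℝ) : Prop where
  finite : IsFiniteMeasure ν
  supp : ∀ᵐ u ∂ν, u ∈ Icc (-1 : ℝ) 1
  bound : ∀ l, p < l → ∃ C, 0 ≤ C ∧ ∀ A, 0 < A → ∀ B, 0 ≤ B →
    ∫ u, (A + B * (1 - u)) ^ (-l) ∂ν ≤ C * A ^ (p - l) * (A + B) ^ (-p)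

lemma integrable_of_continuousOn_Icc {ν : Measure ℝ} [IsFiniteMeasure ν]
    (hν : ∀ᵐ u ∂ν, u ∈ Icc (-1 : ℝ) 1) {f : ℝ → ℝ} (hf : ContinuousOn f (Icc (-1) 1)) :
    Integrable f ν := by
  have h := hf.integrableOn_compact (μ := ν) isCompact_Icc
  rwa [IntegrableOn, Measure.restrict_eq_self_of_ae_mem hν] at h

lemma kernelBound_zero {ν : Measure ℝ} [IsFiniteMeasure ν]
    (hν : ∀ᵐ u ∂ν, u ∈ Icc (-1 : ℝ) 1) : KernelBound ν 0 := by
  refine ⟨inferInstance, hν, fun l hl => ⟨ν.real univ, by positivity, fun A hA B hB => ?_⟩⟩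
  have h : ∀ᵐ u ∂ν, (A + B * (1 - u)) ^ (-l) ≤ A ^ (-l) := by
    filter_upwards [hν] with u hu
    exact Real.rpow_le_rpow_of_nonpos hA (by nlinarith [hu.2]) (by linarith)
  have h0 : ∀ᵐ u ∂ν, 0 ≤ (A + B * (1 - u)) ^ (-l) := by
    filter_upwards [hν] with u hu
    have : 0 ≤ 1 - u := by linarith [hu.2]
    positivity
  calc ∫ u, (A + B * (1 - u)) ^ (-l) ∂ν ≤ ∫ _, A ^ (-l) ∂ν :=
        integral_mono_of_nonneg h0 (integrable_const _) h
    _ = _ := by simp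

lemma jacobiWeight_le {a p u : ℝ} (hp : p ≤ a + 1 / 2) (hu : u ∈ Ioo (-1 : ℝ) 1) :
    (1 - u ^ 2) ^ (a - 1 / 2) ≤ (1 + 2 ^ (a - 1 / 2)) * (1 - |u|) ^ (p - 1) := by
  have h1 : |u| < 1 := abs_lt.2 hu
  have h0 := abs_nonneg u
  have e : 1 - u ^ 2 = (1 + |u|) * (1 - |u|) := by rw [← sq_abs]; ring
  have h2 : (1 + |u|) ^ (a - 1 / 2) ≤ 1 + 2 ^ (a - 1 / 2) := by
    have := rpow_le_mul_rpow (c := 1) (d := 2) (x := 1) (y := 1 + |u|) (a - 1 / 2) one_pos one_pos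
      (by linarith) (by linarith)
    simpa using this
  rw [e, Real.mul_rpow (by linarith) (by linarith)]
  have h3 : 0 < 1 - |u| := by linarith
  gcongr ?_ * ?_
  exact Real.rpow_le_rpow_of_exponent_ge h3 (by linarith) (by linarith)

lemma integrableOn_jacobiWeight {a : ℝ} (ha : -(1 / 2) < a) :
    IntegrableOn (fun u : ℝ => (1 - u ^ 2) ^ (a - 1 / 2)) (Icc (-1) 1) := by
  have h := (integral_comp_one_sub_abs (H := fun y => y ^ (a + 1 / 2 - 1))
    (intervalIntegral.intervalIntegrable_rpow' (by linarith))).1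
  rw [intervalIntegrable_iff_integrableOn_Ioo_of_le (by norm_num)] at h
  rw [integrableOn_Icc_iff_integrableOn_Ioo]
  refine Integrable.mono' (h.const_mul (1 + 2 ^ (a - 1 / 2))) ?_ ?_
  · exact (by fun_prop : Measurable fun u : ℝ => (1 - u ^ 2) ^ (a - 1 / 2)).aestronglyMeasurable
  · refine (ae_restrict_iff' measurableSet_Ioo).2 (.of_forall fun u hu => ?_)
    have : 0 ≤ 1 - u ^ 2 := by nlinarith [hu.1, hu.2]
    rw [Real.norm_of_nonneg (by positivity)]
    exact jacobiWeight_le le_rfl hu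

lemma jacobiPi_finite_supp {a : ℝ} (ha : -(1 / 2) ≤ a) :
    IsFiniteMeasure (jacobiPi a) ∧ ∀ᵐ u ∂(jacobiPi a), u ∈ Icc (-1 : ℝ) 1 := by
  unfold jacobiPi
  split_ifs with h
  · refine ⟨⟨?_⟩, ?_⟩
    · simp
    · refine Measure.ae_smul_measure ?_ _
      rw [ae_add_measure_iff]
      simp [ae_dirac_eq]
  · refine ⟨?_, ?_⟩
    · refine isFiniteMeasure_withDensity_ofReal ?_
      exact ((integrableOn_jacobiWeight (lt_of_le_of_ne ha (Ne.symm h))).const_mul _).2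
    · exact (withDensity_absolutelyContinuous _ _).ae_le (ae_restrict_mem measurableSet_Icc)

lemma jacobiPi_integral_le {a p : ℝ} (ha : -(1 / 2) < a) (hp : p ≤ a + 1 / 2) :
    ∃ C, 0 ≤ C ∧ ∀ F : ℝ → ℝ, (∀ u ∈ Ioo (-1 : ℝ) 1, 0 ≤ F u) →
      ∀ H : ℝ → ℝ, (∀ u ∈ Ioo (-1 : ℝ) 1, F u ≤ H (1 - |u|)) →
      IntervalIntegrable (fun y => y ^ (p - 1) * H y) volume 0 1 →
      ∫ u, F u ∂(jacobiPi a) ≤ C * ∫ y in (0 : ℝ)..1, y ^ (p - 1) * H y := by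
  set c := Real.Gamma (a + 1) / (√π * Real.Gamma (a + 1 / 2)) with hc
  have hc0 : 0 < c := by
    have := Real.Gamma_pos_of_pos (show 0 < a + 1 by linarith)
    have := Real.Gamma_pos_of_pos (show 0 < a + 1 / 2 by linarith)
    positivity
  set D : ℝ := 1 + 2 ^ (a - 1 / 2) with hD
  have hD0 : 0 < D := by positivity
  refine ⟨2 * (c * D), by positivity, fun F hF0 H hFH hint => ?_⟩
  obtain ⟨hi, he⟩ := integral_comp_one_sub_abs hint
  rw [intervalIntegrable_iff_integrableOn_Ioo_of_le (by norm_num)] at hi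
  rw [jacobiPi, if_neg ha.ne', integral_withDensity_eq_integral_toReal_smul (by fun_prop)
    (.of_forall fun _ => ENNReal.ofReal_lt_top), integral_Icc_eq_integral_Ioo,
    mul_assoc, mul_left_comm, ← he, intervalIntegral.integral_of_le (by norm_num),
    integral_Ioc_eq_integral_Ioo, ← integral_const_mul]
  refine integral_mono_of_nonneg ?_ (hi.const_mul _) ?_
  · refine (ae_restrict_iff' measurableSet_Ioo).2 (.of_forall fun u hu => ?_)
    exact smul_nonneg ENNReal.toReal_nonneg (hF0 u hu)
  · refine (ae_restrict_iff' measurableSet_Ioo).2 (.of_forall fun u hu => ?_)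
    have h0 : 0 ≤ 1 - u ^ 2 := by nlinarith [hu.1, hu.2]
    have h1 : 0 ≤ 1 - |u| := by linarith [abs_lt.2 hu]
    simp only [smul_eq_mul]
    rw [ENNReal.toReal_ofReal (by positivity), ← hc]
    calc c * (1 - u ^ 2) ^ (a - 1 / 2) * F u
        ≤ c * (D * (1 - |u|) ^ (p - 1)) * H (1 - |u|) := by
          gcongr ?_ * ?_
          · exact hF0 u hu
          · exact mul_le_mul_of_nonneg_left (jacobiWeight_le hp hu) hc0.le
          · exact hFH u hu
      _ = _ := by ring

lemma kernelBound_jacobiPi {a p : ℝ} (hp0 : 0 ≤ p) (hp : p ≤ a + 1 / 2) :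
    KernelBound (jacobiPi a) p := by
  obtain ⟨h1, h2⟩ := jacobiPi_finite_supp (a := a) (by linarith)
  rcases hp0.eq_or_lt with rfl | hp0
  · exact kernelBound_zero h2
  refine ⟨h1, h2, fun l hl => ?_⟩
  obtain ⟨C, hC0, hC⟩ := jacobiPi_integral_le (a := a) (by linarith) hp
  refine ⟨C * (1 / p + 1 / (l - p)), ?_, fun A hA B hB => ?_⟩
  · have := sub_pos.2 hl
    positivity
  refine (hC (fun u => (A + B * (1 - u)) ^ (-l)) (fun u hu => ?_)
    (fun y => (A + B * y) ^ (-l)) (fun u hu => ?_) ?_).trans ?_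
  · have : 0 ≤ 1 - u := by linarith [hu.2]
    positivity
  · have : 0 ≤ 1 - |u| := by linarith [abs_lt.2 hu]
    exact Real.rpow_le_rpow_of_nonpos (by positivity) (by nlinarith [le_abs_self u])
      (by linarith)
  · refine (intervalIntegral.intervalIntegrable_rpow' (by linarith)).mul_continuousOn ?_
    refine ContinuousOn.rpow_const (by fun_prop) fun y hy => Or.inl ?_
    rw [uIcc_of_le zero_le_one] at hy
    have := hy.1
    positivity
  · refine (mul_le_mul_of_nonneg_left (integral_mul_rpow_le hp0 hl hA hB) hC0).trans_eq ?_
    ring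

lemma double_kernel_bound {ν₁ ν₂ : Measure ℝ} {p₁ p₂ L : ℝ} (h₁ : KernelBound ν₁ p₁)
    (h₂ : KernelBound ν₂ p₂) (hp₁ : 0 ≤ p₁) (hp₂ : 0 ≤ p₂) (hL : p₁ + p₂ < L) :
    ∃ C, 0 ≤ C ∧ ∀ A, 0 < A → ∀ B₁, 0 ≤ B₁ → ∀ B₂, 0 ≤ B₂ →
      ∫ u, ∫ v, (A + B₁ * (1 - u) + B₂ * (1 - v)) ^ (-L) ∂ν₂ ∂ν₁
        ≤ C * A ^ (p₁ + p₂ - L) * (A + B₁) ^ (-p₁) * (A + B₂) ^ (-p₂) := by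
  obtain ⟨C₂, hC₂, hb₂⟩ := h₂.bound L (by linarith)
  obtain ⟨C₁, hC₁, hb₁⟩ := h₁.bound (L - p₂) (by linarith)
  have := h₁.finite
  refine ⟨C₂ * C₁, by positivity, fun A hA B₁ hB₁ B₂ hB₂ => ?_⟩
  have hcont : ContinuousOn (fun u => (A + B₁ * (1 - u)) ^ (-(L - p₂))) (Icc (-1) 1) := by
    refine ContinuousOn.rpow_const (by fun_prop) fun u hu => Or.inl ?_
    have : 0 ≤ 1 - u := by linarith [hu.2]
    positivity
  calc ∫ u, ∫ v, (A + B₁ * (1 - u) + B₂ * (1 - v)) ^ (-L) ∂ν₂ ∂ν₁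
      ≤ ∫ u, C₂ * (A + B₂) ^ (-p₂) * (A + B₁ * (1 - u)) ^ (-(L - p₂)) ∂ν₁ := by
        refine integral_mono_of_nonneg ?_
          ((integrable_of_continuousOn_Icc h₁.supp hcont).const_mul _) ?_
        · filter_upwards [h₁.supp] with u hu
          refine integral_nonneg_of_ae ?_
          filter_upwards [h₂.supp] with v hv
          have : 0 ≤ 1 - u := by linarith [hu.2]
          have : 0 ≤ 1 - v := by linarith [hv.2]
          simp only [Pi.zero_apply]
          positivity
        · filter_upwards [h₁.supp] with u hu
          have h0 : 0 ≤ 1 - u := by linarith [hu.2]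
          refine (hb₂ (A + B₁ * (1 - u)) (by positivity) B₂ hB₂).trans ?_
          rw [neg_sub, mul_right_comm]
          gcongr ?_ * _
          gcongr ?_ * ?_
          exact Real.rpow_le_rpow_of_nonpos (by positivity) (by nlinarith) (by linarith)
    _ = C₂ * (A + B₂) ^ (-p₂) * ∫ u, (A + B₁ * (1 - u)) ^ (-(L - p₂)) ∂ν₁ :=
        integral_const_mul _ _
    _ ≤ C₂ * (A + B₂) ^ (-p₂) * (C₁ * A ^ (p₁ - (L - p₂)) * (A + B₁) ^ (-p₁)) := by
        gcongr
        exact hb₁ A hA B₁ hB₁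
    _ = _ := by
        rw [show p₁ - (L - p₂) = p₁ + p₂ - L by ring]; ring

/-- The size of the right-hand side of the estimate, up to constants. -/
noncomputable def ballScale (α β s θ φ : ℝ) : ℝ :=
  qMin θ φ ^ (-((1 + s) / 2)) * sinSum θ φ ^ (-(2 * α + 1)) * cosSum θ φ ^ (-(2 * β + 1))

/-- Pointwise control of a nonnegative function of `(t, θ, φ)` which suffices for the weighted
`L²` estimate in `t`. -/
def Controlled (α β W s : ℝ) (f : ℝ → ℝ → ℝ → ℝ) : Prop :=
  ∃ e, 0 < e ∧ ∃ C, 0 ≤ C ∧ ∀ θ ∈ Ioo (0 : ℝ) π, ∀ φ ∈ Ioo (0 : ℝ) π, θ ≠ φ →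
    ∀ t ∈ Ioo (0 : ℝ) π, 0 ≤ f t θ φ ∧ f t θ φ ≤
      C * (ballScale α β s θ φ * (qMin θ φ ^ e * (qMin θ φ + t ^ 2) ^ (-(e + W / 4))))

lemma ballScale_pos {α β s θ φ : ℝ} (hθ : θ ∈ Ioo (0 : ℝ) π) (hφ : φ ∈ Ioo (0 : ℝ) π)
    (hne : θ ≠ φ) : 0 < ballScale α β s θ φ := by
  have := qMin_pos hθ hφ hne
  have := sinSum_pos hθ hφ
  have := cosSum_pos hθ hφ
  unfold ballScale
  positivity

namespace Controlled

variable {α β W s : ℝ} {f g : ℝ → ℝ → ℝ → ℝ}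

lemma rpow_mul_rpow_anti {A X e e' w : ℝ} (hA : 0 < A) (hAX : A ≤ X) (he : e ≤ e') :
    A ^ e' * X ^ (-(e' + w)) ≤ A ^ e * X ^ (-(e + w)) := by
  have hX := hA.trans_le hAX
  have h : (A / X) ^ e' ≤ (A / X) ^ e :=
    Real.rpow_le_rpow_of_exponent_ge (by positivity) ((div_le_one hX).2 hAX) he
  have key : ∀ e : ℝ, A ^ e * X ^ (-(e + w)) = (A / X) ^ e * X ^ (-w) := by
    intro e
    rw [Real.div_rpow hA.le hX.le, neg_add, Real.rpow_add hX, Real.rpow_neg hX.le]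
    ring
  rw [key, key]
  gcongr

lemma add (hf : Controlled α β W s f) (hg : Controlled α β W s g) :
    Controlled α β W s fun t θ φ => f t θ φ + g t θ φ := by
  obtain ⟨e₁, he₁, C₁, hC₁, h₁⟩ := hf
  obtain ⟨e₂, he₂, C₂, hC₂, h₂⟩ := hg
  refine ⟨min e₁ e₂, lt_min he₁ he₂, C₁ + C₂, by positivity, fun θ hθ φ hφ hne t ht => ?_⟩
  obtain ⟨a₁, b₁⟩ := h₁ θ hθ φ hφ hne t ht
  obtain ⟨a₂, b₂⟩ := h₂ θ hθ φ hφ hne t ht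
  refine ⟨add_nonneg a₁ a₂, ?_⟩
  have hA := qMin_pos hθ hφ hne
  have hAX : qMin θ φ ≤ qMin θ φ + t ^ 2 := by nlinarith
  have hG := (ballScale_pos (α := α) (β := β) (s := s) hθ hφ hne).le
  rw [add_mul]
  refine add_le_add (b₁.trans ?_) (b₂.trans ?_)
  · gcongr C₁ * (_ * ?_)
    exact rpow_mul_rpow_anti hA hAX (min_le_left _ _)
  · gcongr C₂ * (_ * ?_)
    exact rpow_mul_rpow_anti hA hAX (min_le_right _ _)

lemma of_le {D : ℝ} (hD : 0 ≤ D) (hg : Controlled α β W s g)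
    (h : ∀ θ ∈ Ioo (0 : ℝ) π, ∀ φ ∈ Ioo (0 : ℝ) π, θ ≠ φ → ∀ t ∈ Ioo (0 : ℝ) π,
      0 ≤ f t θ φ ∧ f t θ φ ≤ D * g t θ φ) : Controlled α β W s f := by
  obtain ⟨e, he, C, hC, h'⟩ := hg
  refine ⟨e, he, D * C, by positivity, fun θ hθ φ hφ hne t ht => ?_⟩
  obtain ⟨a, b⟩ := h θ hθ φ hφ hne t ht
  refine ⟨a, b.trans ?_⟩
  rw [mul_assoc]
  exact mul_le_mul_of_nonneg_left (h' θ hθ φ hφ hne t ht).2 hD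

lemma zero : Controlled α β W s fun _ _ _ => 0 :=
  ⟨1, one_pos, 0, le_rfl, fun _ _ _ _ _ _ _ => by simp⟩

lemma sum {ι : Type*} (I : Finset ι) {F : ι → ℝ → ℝ → ℝ → ℝ}
    (hF : ∀ i ∈ I, Controlled α β W s (F i)) :
    Controlled α β W s fun t θ φ => ∑ i ∈ I, F i t θ φ := by
  classical
  induction I using Finset.induction_on with
  | empty => simpa using zero
  | insert i I hi ih =>
    simp only [Finset.sum_insert hi]
    exact (hF i (by simp)).add (ih fun j hj => hF j (by simp [hj]))

end Controlled

lemma pow_mul_rpow_neg_le {A S Y p α : ℝ} (k : ℕ) (hA : 0 < A) (hS : 0 < S) (hAS : A ≤ S ^ 2)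
    (hY : 1 / 8 * S ^ 2 ≤ Y) (hp : 0 ≤ p) (hd : 0 ≤ p - 1 / 2 - α - k / 2) :
    S ^ k * Y ^ (-p) ≤ 8 ^ p * (S ^ (-(2 * α + 1)) * A ^ (-(p - 1 / 2 - α - k / 2))) := by
  have h1 : Y ^ (-p) ≤ (1 / 8 * S ^ 2) ^ (-p) :=
    Real.rpow_le_rpow_of_nonpos (by positivity) hY (by linarith)
  have h2 : (S ^ 2) ^ (-(p - 1 / 2 - α - k / 2)) ≤ A ^ (-(p - 1 / 2 - α - k / 2)) :=
    Real.rpow_le_rpow_of_nonpos hA hAS (by linarith)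
  calc S ^ k * Y ^ (-p) ≤ S ^ k * (1 / 8 * S ^ 2) ^ (-p) := by gcongr
    _ = 8 ^ p * (S ^ (-(2 * α + 1)) * (S ^ 2) ^ (-(p - 1 / 2 - α - k / 2))) := by
        rw [Real.mul_rpow (by norm_num) (by positivity), one_div, Real.inv_rpow (by norm_num),
          Real.rpow_neg (by norm_num), inv_inv, mul_left_comm, ← Real.rpow_natCast,
          ← Real.rpow_natCast, ← Real.rpow_mul hS.le, ← Real.rpow_mul hS.le, ← Real.rpow_add hS,
          ← Real.rpow_add hS]
        congr 2; push_cast; ring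
    _ ≤ _ := by gcongr

lemma sq_add_q_eq (t θ φ u v : ℝ) :
    t ^ 2 + q θ φ u v = qMin θ φ + t ^ 2 + Real.sin (θ / 2) * Real.sin (φ / 2) * (1 - u)
      + Real.cos (θ / 2) * Real.cos (φ / 2) * (1 - v) := by
  rw [q_eq]; ring

lemma qMin_add_sq_le_sq_add_q {t θ φ u v : ℝ} (hθ : θ ∈ Ioo (0 : ℝ) π) (hφ : φ ∈ Ioo (0 : ℝ) π)
    (hu : u ∈ Icc (-1 : ℝ) 1) (hv : v ∈ Icc (-1 : ℝ) 1) :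
    qMin θ φ + t ^ 2 ≤ t ^ 2 + q θ φ u v := by
  have h1 := mul_nonneg (mul_pos (sin_half_pos hθ) (sin_half_pos hφ)).le (sub_nonneg.2 hu.2)
  have h2 := mul_nonneg (mul_pos (cos_half_pos hθ) (cos_half_pos hφ)).le (sub_nonneg.2 hv.2)
  rw [sq_add_q_eq]; linarith

lemma sq_add_q_le {t θ φ u v : ℝ} (hθ : θ ∈ Ioo (0 : ℝ) π) (hφ : φ ∈ Ioo (0 : ℝ) π)
    (ht : t ∈ Ioo (0 : ℝ) π) (hu : u ∈ Icc (-1 : ℝ) 1) (hv : v ∈ Icc (-1 : ℝ) 1) :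
    t ^ 2 + q θ φ u v ≤ π ^ 2 + 6 := by
  have s1 := sin_half_pos hθ
  have s2 := sin_half_pos hφ
  have c1 := cos_half_pos hθ
  have c2 := cos_half_pos hφ
  have h1 : Real.sin (θ / 2) * Real.sin (φ / 2) ≤ 1 :=
    mul_le_one₀ (Real.sin_le_one _) s2.le (Real.sin_le_one _)
  have h2 : Real.cos (θ / 2) * Real.cos (φ / 2) ≤ 1 :=
    mul_le_one₀ (Real.cos_le_one _) c2.le (Real.cos_le_one _)
  have h3 := mul_pos s1 s2
  have h4 := mul_pos c1 c2
  have h5 : t ^ 2 ≤ π ^ 2 := by nlinarith [ht.1, ht.2]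
  rw [sq_add_q_eq]
  nlinarith [qMin_le_two θ φ, hu.1, hu.2, hv.1, hv.2]

lemma integral_integral_rpow_nonneg {ν₁ ν₂ : Measure ℝ} (h₁ : ∀ᵐ u ∂ν₁, u ∈ Icc (-1 : ℝ) 1)
    (h₂ : ∀ᵐ u ∂ν₂, u ∈ Icc (-1 : ℝ) 1) {t θ φ : ℝ} (hθ : θ ∈ Ioo (0 : ℝ) π)
    (hφ : φ ∈ Ioo (0 : ℝ) π) (hne : θ ≠ φ) (L : ℝ) :
    0 ≤ ∫ u, ∫ v, (t ^ 2 + q θ φ u v) ^ (-L) ∂ν₂ ∂ν₁ := by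
  refine integral_nonneg_of_ae ?_
  filter_upwards [h₁] with u hu
  refine integral_nonneg_of_ae ?_
  filter_upwards [h₂] with v hv
  have := qMin_add_sq_le_sq_add_q (t := t) hθ hφ hu hv
  have := qMin_pos hθ hφ hne
  have : 0 ≤ t ^ 2 + q θ φ u v := by nlinarith
  simp only [Pi.zero_apply]
  positivity

lemma controlled_term {α β W s p₁ p₂ L : ℝ} {ν₁ ν₂ : Measure ℝ} (k r : ℕ) (hW : 0 < W)
    (h₁ : KernelBound ν₁ p₁) (h₂ : KernelBound ν₂ p₂) (hp₁ : 0 ≤ p₁) (hp₂ : 0 ≤ p₂)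
    (hd₁ : 0 ≤ p₁ - 1 / 2 - α - k / 2) (hd₂ : 0 ≤ p₂ - 1 / 2 - β - r / 2)
    (hd : (p₁ - 1 / 2 - α - k / 2) + (p₂ - 1 / 2 - β - r / 2) < (1 + s) / 2)
    (hL : L = α + β + 3 / 2 + W / 4 + k / 2 + r / 2 + s / 2) :
    Controlled α β W s fun t θ φ => sinSum θ φ ^ k * cosSum θ φ ^ r *
      ∫ u, ∫ v, (t ^ 2 + q θ φ u v) ^ (-L) ∂ν₂ ∂ν₁ := by
  obtain ⟨C, hC, hb⟩ := double_kernel_bound (L := L) h₁ h₂ hp₁ hp₂ (by linarith)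
  refine ⟨(1 + s) / 2 - ((p₁ - 1 / 2 - α - k / 2) + (p₂ - 1 / 2 - β - r / 2)), by linarith,
    C * 8 ^ p₁ * 8 ^ p₂, by positivity, fun θ hθ φ hφ hne t ht => ?_⟩
  have hA := qMin_pos hθ hφ hne
  have hS := sinSum_pos hθ hφ
  have hCo := cosSum_pos hθ hφ
  refine ⟨mul_nonneg (by positivity)
    (integral_integral_rpow_nonneg h₁.supp h₂.supp hθ hφ hne L), ?_⟩
  have hs := mul_pos (sin_half_pos hθ) (sin_half_pos hφ)
  have hc := mul_pos (cos_half_pos hθ) (cos_half_pos hφ)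
  have b := hb (qMin θ φ + t ^ 2) (by positivity) _ hs.le _ hc.le
  simp only [← sq_add_q_eq] at b
  have b₁ := pow_mul_rpow_neg_le (p := p₁) (α := α) k hA hS (qMin_le_sinSum_sq hθ hφ)
    (Y := qMin θ φ + t ^ 2 + Real.sin (θ / 2) * Real.sin (φ / 2))
    ((sinSum_sq_le hθ hφ).trans (by nlinarith)) hp₁ hd₁
  have b₂ := pow_mul_rpow_neg_le (p := p₂) (α := β) r hA hCo (qMin_le_cosSum_sq hθ hφ)
    (Y := qMin θ φ + t ^ 2 + Real.cos (θ / 2) * Real.cos (φ / 2))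
    ((cosSum_sq_le hθ hφ).trans (by nlinarith)) hp₂ hd₂
  set d₁ := p₁ - 1 / 2 - α - k / 2 with hd₁'
  set d₂ := p₂ - 1 / 2 - β - r / 2 with hd₂'
  set X := qMin θ φ + t ^ 2 with hX
  have hX0 : 0 < X := by positivity
  have eX : p₁ + p₂ - L = -((1 + s) / 2 - (d₁ + d₂) + W / 4) := by
    rw [hL, hd₁', hd₂']; ring
  rw [eX] at b
  have eA : qMin θ φ ^ (-((1 + s) / 2)) * qMin θ φ ^ ((1 + s) / 2 - (d₁ + d₂))
      = qMin θ φ ^ (-d₁) * qMin θ φ ^ (-d₂) := by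
    rw [← Real.rpow_add hA, ← Real.rpow_add hA]; congr 1; ring
  calc _ ≤ sinSum θ φ ^ k * cosSum θ φ ^ r * _ := mul_le_mul_of_nonneg_left b (by positivity)
    _ = C * X ^ (-((1 + s) / 2 - (d₁ + d₂) + W / 4)) *
        ((sinSum θ φ ^ k * (X + Real.sin (θ / 2) * Real.sin (φ / 2)) ^ (-p₁)) *
        (cosSum θ φ ^ r * (X + Real.cos (θ / 2) * Real.cos (φ / 2)) ^ (-p₂))) := by ring
    _ ≤ C * X ^ (-((1 + s) / 2 - (d₁ + d₂) + W / 4)) *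
        ((8 ^ p₁ * (sinSum θ φ ^ (-(2 * α + 1)) * qMin θ φ ^ (-d₁))) *
        (8 ^ p₂ * (cosSum θ φ ^ (-(2 * β + 1)) * qMin θ φ ^ (-d₂)))) := by
        gcongr
    _ = C * 8 ^ p₁ * 8 ^ p₂ * (sinSum θ φ ^ (-(2 * α + 1)) * cosSum θ φ ^ (-(2 * β + 1)) *
        (qMin θ φ ^ (-d₁) * qMin θ φ ^ (-d₂)) *
        X ^ (-((1 + s) / 2 - (d₁ + d₂) + W / 4))) := by ring
    _ = _ := by rw [← eA, ballScale]; ring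

lemma controlled_rpow {α β W s m : ℝ} (hm : -1 < m) (hm' : m ≤ -(1 / 2)) (hα : m ≤ α)
    (hβ : m ≤ β) (hs : 0 ≤ s) :
    Controlled α β W s fun t θ φ => (qMin θ φ + t ^ 2) ^ (-(m + 1 + s / 2 + W / 4)) := by
  refine ⟨m + 1 + s / 2, by linarith,
    2 ^ (-(2 * m + 1)) * 2 ^ (2 * (α - m)) * 2 ^ (2 * (β - m)), by positivity,
    fun θ hθ φ hφ hne t ht => ?_⟩
  have hA := qMin_pos hθ hφ hne
  have hS := sinSum_pos hθ hφ
  have hCo := cosSum_pos hθ hφ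
  refine ⟨by positivity, ?_⟩
  have step : ∀ S a : ℝ, 0 < S → S ≤ 2 → m ≤ a →
      S ^ (-(2 * m + 1)) ≤ 2 ^ (2 * (a - m)) * S ^ (-(2 * a + 1)) := by
    intro S a hS hS2 ha
    have : S ^ (-(2 * m + 1)) = S ^ (2 * (a - m)) * S ^ (-(2 * a + 1)) := by
      rw [← Real.rpow_add hS]; congr 1; ring
    rw [this]
    gcongr
  have h1 := step _ α hS (sinSum_le_two θ φ) hα
  have h2 := step _ β hCo (cosSum_le_two θ φ) hβ
  have h3 : qMin θ φ ^ (-(m + 1 / 2))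
      ≤ 2 ^ (-(2 * m + 1)) * (sinSum θ φ ^ (-(2 * m + 1)) * cosSum θ φ ^ (-(2 * m + 1))) := by
    rw [← Real.mul_rpow hS.le hCo.le, ← Real.mul_rpow (by norm_num) (by positivity)]
    have := Real.rpow_le_rpow (Real.sqrt_nonneg _) (sqrt_qMin_le_sinSum_mul_cosSum hθ hφ)
      (show 0 ≤ -(2 * m + 1) by linarith)
    refine le_trans (le_of_eq ?_) this
    rw [Real.sqrt_eq_rpow, ← Real.rpow_mul hA.le]
    congr 1; ring
  have h4 : (1 : ℝ) = qMin θ φ ^ (m + 1 / 2) * qMin θ φ ^ (-(m + 1 / 2)) := by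
    rw [← Real.rpow_add hA]; simp
  have h5 : qMin θ φ ^ (-((1 + s) / 2)) * qMin θ φ ^ (m + 1 + s / 2)
      = qMin θ φ ^ (m + 1 / 2) := by
    rw [← Real.rpow_add hA]; congr 1; ring
  have key : 1 ≤ 2 ^ (-(2 * m + 1)) * 2 ^ (2 * (α - m)) * 2 ^ (2 * (β - m)) *
      (ballScale α β s θ φ * qMin θ φ ^ (m + 1 + s / 2)) := by
    calc (1 : ℝ) = qMin θ φ ^ (m + 1 / 2) * qMin θ φ ^ (-(m + 1 / 2)) := h4
      _ ≤ qMin θ φ ^ (m + 1 / 2) * (2 ^ (-(2 * m + 1)) *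
          ((2 ^ (2 * (α - m)) * sinSum θ φ ^ (-(2 * α + 1))) *
          (2 ^ (2 * (β - m)) * cosSum θ φ ^ (-(2 * β + 1))))) := by
          refine mul_le_mul_of_nonneg_left (h3.trans ?_) (by positivity)
          gcongr
      _ = _ := by rw [← h5, ballScale]; ring
  have hX : 0 ≤ (qMin θ φ + t ^ 2) ^ (-(m + 1 + s / 2 + W / 4)) := by positivity
  calc _ ≤ _ := le_mul_of_one_le_left hX key
    _ = _ := by ring

lemma controlled_one {α β W s m : ℝ} (hm : -1 < m) (hm' : m ≤ -(1 / 2)) (hα : m ≤ α)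
    (hβ : m ≤ β) (hW : 0 < W) (hs : 0 ≤ s) : Controlled α β W s fun _ _ _ => 1 := by
  refine (controlled_rpow hm hm' hα hβ hs (W := W)).of_le
    (D := (π ^ 2 + 6) ^ (m + 1 + s / 2 + W / 4)) (by positivity)
    fun θ hθ φ hφ hne t ht => ⟨zero_le_one, ?_⟩
  have hA := qMin_pos hθ hφ hne
  have hX : qMin θ φ + t ^ 2 ≤ π ^ 2 + 6 := by nlinarith [ht.1, ht.2, qMin_le_two θ φ]
  rw [Real.rpow_neg (by positivity), ← div_eq_mul_inv, one_le_div (by positivity)]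
  exact Real.rpow_le_rpow (by positivity) hX (by linarith)

lemma controlled_term_zero {α β W s m L : ℝ} {ν₁ ν₂ : Measure ℝ} (hm : -1 < m)
    (hm' : m ≤ -(1 / 2)) (hα : m ≤ α) (hβ : m ≤ β) (hW : 0 < W) (hs : 0 ≤ s)
    (h₁ : KernelBound ν₁ 0) (h₂ : KernelBound ν₂ 0) (hL : L ≤ m + 1 + s / 2 + W / 4) :
    Controlled α β W s fun t θ φ => ∫ u, ∫ v, (t ^ 2 + q θ φ u v) ^ (-L) ∂ν₂ ∂ν₁ := by
  have := h₁.finite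
  have := h₂.finite
  set g := m + 1 + s / 2 + W / 4 with hg
  refine (controlled_rpow hm hm' hα hβ hs (W := W)).of_le
    (D := ν₁.real univ * (ν₂.real univ * (π ^ 2 + 6) ^ (g - L))) (by positivity)
    fun θ hθ φ hφ hne t ht =>
      ⟨integral_integral_rpow_nonneg h₁.supp h₂.supp hθ hφ hne L, ?_⟩
  have hA := qMin_pos hθ hφ hne
  have hX : 0 < qMin θ φ + t ^ 2 := by positivity
  have key : ∀ u ∈ Icc (-1 : ℝ) 1, ∀ v ∈ Icc (-1 : ℝ) 1, 0 ≤ (t ^ 2 + q θ φ u v) ^ (-L) ∧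
      (t ^ 2 + q θ φ u v) ^ (-L) ≤ (π ^ 2 + 6) ^ (g - L) * (qMin θ φ + t ^ 2) ^ (-g) := by
    intro u hu v hv
    have l1 := qMin_add_sq_le_sq_add_q (t := t) hθ hφ hu hv
    have l2 := sq_add_q_le hθ hφ ht hu hv
    have l0 := hX.trans_le l1
    refine ⟨by positivity, ?_⟩
    rw [show -L = (g - L) + -g by ring, Real.rpow_add l0]
    gcongr ?_ * ?_
    · exact Real.rpow_le_rpow l0.le l2 (by linarith)
    · exact Real.rpow_le_rpow_of_nonpos hX l1 (by linarith)
  calc ∫ u, ∫ v, (t ^ 2 + q θ φ u v) ^ (-L) ∂ν₂ ∂ν₁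
      ≤ ∫ _, ν₂.real univ * ((π ^ 2 + 6) ^ (g - L) * (qMin θ φ + t ^ 2) ^ (-g)) ∂ν₁ := by
        refine integral_mono_of_nonneg ?_ (integrable_const _) ?_
        · filter_upwards [h₁.supp] with u hu
          refine integral_nonneg_of_ae ?_
          filter_upwards [h₂.supp] with v hv using (key u hu v hv).1
        · filter_upwards [h₁.supp] with u hu
          calc ∫ v, (t ^ 2 + q θ φ u v) ^ (-L) ∂ν₂
              ≤ ∫ _, (π ^ 2 + 6) ^ (g - L) * (qMin θ φ + t ^ 2) ^ (-g) ∂ν₂ := by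
                refine integral_mono_of_nonneg ?_ (integrable_const _) ?_
                · filter_upwards [h₂.supp] with v hv using (key u hu v hv).1
                · filter_upwards [h₂.supp] with v hv using (key u hu v hv).2
            _ = _ := by simp
    _ = _ := by simp only [integral_const, smul_eq_mul, ← hg]; ring

lemma controlled_Ups {α β W s : ℝ} (hα : -1 < α) (hβ : -1 < β) (hW : 1 ≤ W) (hs : 0 ≤ s) :
    Controlled α β W s fun t θ φ => Ups α β W s t θ φ := by
  have hW0 : 0 < W := by linarith
  have hK : ∀ a : ℝ, -1 < a → a < -(1 / 2) → ∀ K ∈ Finset.range 2, ∀ k ∈ Finset.range 3,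
      (K * k = 0 ∧ KernelBound (jacobiPiK a K) 0) ∨
      (0 ≤ a + 1 / 2 + ((K * k : ℕ) : ℝ) / 2 ∧
        KernelBound (jacobiPiK a K) (a + 1 / 2 + ((K * k : ℕ) : ℝ) / 2)) := by
    intro a ha ha' K hK k hk
    have hK2 := Finset.mem_range.1 hK
    have hk3 := Finset.mem_range.1 hk
    interval_cases K
    · left
      refine ⟨by simp, ?_⟩
      rw [jacobiPiK, if_pos rfl]
      exact kernelBound_jacobiPi le_rfl (by norm_num)
    · rw [jacobiPiK, if_neg one_ne_zero, one_mul]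
      interval_cases k
      · left
        exact ⟨rfl, kernelBound_jacobiPi le_rfl (by linarith)⟩
      · right
        push_cast
        exact ⟨by linarith, kernelBound_jacobiPi (by linarith) (by linarith)⟩
      · right
        push_cast
        exact ⟨by linarith, kernelBound_jacobiPi (by linarith) (by linarith)⟩
  unfold Ups
  split_ifs with ha hb hb
  · have := controlled_term (α := α) (β := β) (W := W) (s := s) 0 0 hW0
      (kernelBound_jacobiPi (a := α) (p := α + 1 / 2) (by linarith) le_rfl)
      (kernelBound_jacobiPi (a := β) (p := β + 1 / 2) (by linarith) le_rfl)
      (by linarith) (by linarith) (by push_cast; linarith) (by push_cast; linarith)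
      (by push_cast; linarith) (L := α + β + 3 / 2 + W / 4 + s / 2) (by push_cast; ring)
    simpa only [pow_zero, one_mul] using this
  · push Not at hb
    refine (controlled_one (m := β) hβ hb.le (by linarith) le_rfl hW0 hs).add
      (Controlled.sum _ fun R hR => Controlled.sum _ fun r hr => ?_)
    have h₁ := kernelBound_jacobiPi (a := α) (p := α + 1 / 2) (by linarith) le_rfl
    obtain ⟨h0, h₂⟩ | ⟨h0, h₂⟩ := hK β hβ hb R hR r hr
    · have := controlled_term (α := α) (β := β) (W := W) (s := s) 0 (R * r) hW0 h₁ h₂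
        (by linarith) le_rfl (by push_cast; linarith) (by rw [h0]; push_cast; linarith)
        (by rw [h0]; push_cast; linarith)
        (L := α + β + 3 / 2 + W / 4 + ((R * r : ℕ) : ℝ) / 2 + s / 2) (by push_cast; ring)
      simpa only [pow_zero, one_mul, cosSum] using this
    · have := controlled_term (α := α) (β := β) (W := W) (s := s) 0 (R * r) hW0 h₁ h₂
        (by linarith) h0 (by push_cast; linarith) (by linarith)
        (by push_cast; linarith)
        (L := α + β + 3 / 2 + W / 4 + ((R * r : ℕ) : ℝ) / 2 + s / 2) (by push_cast; ring)
      simpa only [pow_zero, one_mul, cosSum] using this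
  · push Not at ha
    refine (controlled_one (m := α) hα ha.le le_rfl (by linarith) hW0 hs).add
      (Controlled.sum _ fun K hK' => Controlled.sum _ fun k hk => ?_)
    have h₂ := kernelBound_jacobiPi (a := β) (p := β + 1 / 2) (by linarith) le_rfl
    obtain ⟨h0, h₁⟩ | ⟨h0, h₁⟩ := hK α hα ha K hK' k hk
    · have := controlled_term (α := α) (β := β) (W := W) (s := s) (K * k) 0 hW0 h₁ h₂
        le_rfl (by linarith) (by rw [h0]; push_cast; linarith) (by push_cast; linarith)
        (by rw [h0]; push_cast; linarith)
        (L := α + β + 3 / 2 + W / 4 + ((K * k : ℕ) : ℝ) / 2 + s / 2) (by push_cast; ring)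
      simpa only [pow_zero, mul_one, sinSum] using this
    · have := controlled_term (α := α) (β := β) (W := W) (s := s) (K * k) 0 hW0 h₁ h₂
        h0 (by linarith) (by linarith) (by push_cast; linarith)
        (by push_cast; linarith)
        (L := α + β + 3 / 2 + W / 4 + ((K * k : ℕ) : ℝ) / 2 + s / 2) (by push_cast; ring)
      simpa only [pow_zero, mul_one, sinSum] using this
  · push Not at ha hb
    have hm : -1 < min α β := lt_min hα hβ
    have hm' : min α β ≤ -(1 / 2) := (min_le_left _ _).trans ha.le
    refine (controlled_one hm hm' (min_le_left _ _) (min_le_right _ _) hW0 hs).add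
      (Controlled.sum _ fun K hK' => Controlled.sum _ fun R hR => Controlled.sum _ fun k hk =>
        Controlled.sum _ fun r hr => ?_)
    obtain ⟨h0, h₁⟩ | ⟨h0, h₁⟩ := hK α hα ha K hK' k hk <;>
      obtain ⟨h0', h₂⟩ | ⟨h0', h₂⟩ := hK β hβ hb R hR r hr
    · have hmax : max α β ≤ -(1 / 2) := max_le ha.le hb.le
      have hsum := min_add_max α β
      have := controlled_term_zero (α := α) (β := β) (W := W) (s := s) hm hm' (min_le_left _ _)
        (min_le_right _ _) hW0 hs h₁ h₂
        (L := α + β + 3 / 2 + W / 4 + ((K * k : ℕ) : ℝ) / 2 + ((R * r : ℕ) : ℝ) / 2 + s / 2)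
        (by rw [h0, h0']; push_cast; linarith)
      simpa only [h0, h0', pow_zero, one_mul] using this
    · exact controlled_term (K * k) (R * r) hW0 h₁ h₂ le_rfl h0'
        (by rw [h0]; push_cast; linarith) (by linarith) (by rw [h0]; push_cast; linarith) rfl
    · exact controlled_term (K * k) (R * r) hW0 h₁ h₂ h0 le_rfl (by linarith)
        (by rw [h0']; push_cast; linarith) (by rw [h0']; push_cast; linarith) rfl
    · exact controlled_term (K * k) (R * r) hW0 h₁ h₂ h0 h0' (by linarith)
        (by linarith) (by linarith) rfl

lemma Controlled.sqrt_integral_le {α β W s : ℝ} {f : ℝ → ℝ → ℝ → ℝ}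
    (hf : Controlled α β W s f) (hW : 1 ≤ W) :
    ∃ C, 0 ≤ C ∧ ∀ θ ∈ Ioo (0 : ℝ) π, ∀ φ ∈ Ioo (0 : ℝ) π, θ ≠ φ →
      (∫ t in Ioo (0 : ℝ) π, f t θ φ ^ 2 * t ^ (W - 1)) ^ ((1 : ℝ) / 2)
        ≤ C * ballScale α β s θ φ := by
  obtain ⟨e, he, C, hC, h⟩ := hf
  refine ⟨C * √(1 / W + 1 / (4 * e)), by positivity, fun θ hθ φ hφ hne => ?_⟩
  have hA := qMin_pos hθ hφ hne
  have hG := ballScale_pos (α := α) (β := β) (s := s) hθ hφ hne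
  set A := qMin θ φ with hAdef
  set G := ballScale α β s θ φ with hGdef
  have hint : IntegrableOn (fun t : ℝ => (A + t ^ 2) ^ (-(2 * e + W / 2)) * t ^ (W - 1))
      (Ioo 0 π) := by
    refine (ContinuousOn.integrableOn_Icc ?_).mono_set Ioo_subset_Icc_self
    refine ContinuousOn.mul (ContinuousOn.rpow_const (by fun_prop) fun t _ => Or.inl ?_)
      (ContinuousOn.rpow_const (by fun_prop) fun t _ => Or.inr (by linarith))
    positivity
  have key : ∫ t in Ioo (0 : ℝ) π, f t θ φ ^ 2 * t ^ (W - 1)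
      ≤ (C * G) ^ 2 * (1 / W + 1 / (4 * e)) := by
    calc ∫ t in Ioo (0 : ℝ) π, f t θ φ ^ 2 * t ^ (W - 1)
        ≤ ∫ t in Ioo (0 : ℝ) π, (C * G) ^ 2 * A ^ (2 * e) *
            ((A + t ^ 2) ^ (-(2 * e + W / 2)) * t ^ (W - 1)) := by
          refine integral_mono_of_nonneg ?_ (hint.const_mul _) ?_
          · refine (ae_restrict_iff' measurableSet_Ioo).2 (.of_forall fun t ht => ?_)
            have := ht.1
            simp only [Pi.zero_apply]
            positivity
          · refine (ae_restrict_iff' measurableSet_Ioo).2 (.of_forall fun t ht => ?_)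
            obtain ⟨h0, h1⟩ := h θ hθ φ hφ hne t ht
            have ht0 := ht.1
            have hX : 0 < A + t ^ 2 := by positivity
            have e1 : A ^ (2 * e) = (A ^ e) ^ 2 := by
              rw [← Real.rpow_mul_natCast hA.le]; congr 1; push_cast; ring
            have e2 : (A + t ^ 2) ^ (-(2 * e + W / 2)) = ((A + t ^ 2) ^ (-(e + W / 4))) ^ 2 := by
              rw [← Real.rpow_mul_natCast hX.le]; congr 1; push_cast; ring
            calc f t θ φ ^ 2 * t ^ (W - 1)
                ≤ (C * (G * (A ^ e * (A + t ^ 2) ^ (-(e + W / 4))))) ^ 2 * t ^ (W - 1) := by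
                  gcongr
              _ = _ := by simp only [e1, e2]; ring
      _ = (C * G) ^ 2 * A ^ (2 * e) *
            ∫ t in Ioo (0 : ℝ) π, (A + t ^ 2) ^ (-(2 * e + W / 2)) * t ^ (W - 1) :=
          integral_const_mul _ _
      _ ≤ (C * G) ^ 2 * A ^ (2 * e) * ((1 / W + 1 / (4 * e)) * A ^ (-(2 * e))) := by
          gcongr
          exact integral_add_sq_rpow_le (by linarith) he hA
      _ = (C * G) ^ 2 * (1 / W + 1 / (4 * e)) * (A ^ (2 * e) * A ^ (-(2 * e))) := by ring
      _ = _ := by rw [← Real.rpow_add hA]; simp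
  rw [← Real.sqrt_eq_rpow]
  calc _ ≤ √((C * G) ^ 2 * (1 / W + 1 / (4 * e))) := Real.sqrt_le_sqrt key
    _ = _ := by
      rw [Real.sqrt_mul (by positivity), Real.sqrt_sq (by positivity)]; ring

lemma setLIntegral_rpow_le {a : ℝ} (ha : -1 < a) :
    ∃ C, 0 < C ∧ ∀ y r : ℝ, 0 < y → 0 < r →
      ∫⁻ x in Ioo (y - r) (y + r) ∩ Ioi 0, ENNReal.ofReal (x ^ a)
        ≤ ENNReal.ofReal (C * r * (y + r) ^ a) := by
  have ha1 : 0 < a + 1 := by linarith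
  refine ⟨2 * (1 + 1 / (a + 1)), by positivity, fun y r hy hr => ?_⟩
  set z := max 0 (y - r) with hz
  have hz0 : 0 ≤ z := le_max_left _ _
  have hzy : z ≤ y + r := max_le (by linarith) (by linarith)
  have hlen : y + r - z ≤ 2 * r := by linarith [le_max_right 0 (y - r)]
  have hyr : 0 < y + r := by linarith
  have hset : Ioo (y - r) (y + r) ∩ Ioi 0 = Ioo z (y + r) := by
    ext x; simp [hz, and_comm, and_assoc]
  have hi := intervalIntegral.intervalIntegrable_rpow' ha (a := z) (b := y + r)
  rw [hset, ← ofReal_integral_eq_lintegral_ofReal]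
  · apply ENNReal.ofReal_le_ofReal
    rw [← integral_Ioc_eq_integral_Ioo, ← intervalIntegral.integral_of_le hzy,
      integral_rpow (Or.inl ha), Real.rpow_add_one hyr.ne']
    rcases le_total 0 a with h0 | h0
    · have h1 : ∫ x in z..y + r, x ^ a ≤ ∫ x in z..y + r, (y + r) ^ a := by
        refine intervalIntegral.integral_mono_on hzy hi (by simp) fun x hx => ?_
        exact Real.rpow_le_rpow (hz0.trans hx.1) hx.2 h0
      rw [integral_rpow (Or.inl ha), Real.rpow_add_one hyr.ne', intervalIntegral.integral_const,
        smul_eq_mul] at h1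
      have h2 : (y + r - z) * (y + r) ^ a ≤ 2 * r * (y + r) ^ a := by gcongr
      have h3 : 0 ≤ 2 * (1 / (a + 1)) * r * (y + r) ^ a := by positivity
      linarith
    · have h1 : (y + r) ^ a * z ≤ z ^ (a + 1) := by
        rcases hz0.eq_or_lt with h | h
        · rw [← h, mul_zero]; exact Real.rpow_nonneg le_rfl _
        · rw [Real.rpow_add_one h.ne']
          gcongr ?_ * _
          exact Real.rpow_le_rpow_of_nonpos h hzy h0
      have h2 : (y + r - z) * (y + r) ^ a ≤ 2 * r * (y + r) ^ a := by gcongr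
      have h3 : 0 ≤ 2 * r * (y + r) ^ a := by positivity
      calc _ ≤ 2 * r * (y + r) ^ a / (a + 1) := by
            gcongr
            linarith
        _ ≤ 2 * r * (y + r) ^ a / (a + 1) + 2 * r * (y + r) ^ a := by linarith
        _ = _ := by ring
  · rw [← IntegrableOn, ← intervalIntegrable_iff_integrableOn_Ioo_of_le hzy]
    exact hi
  · refine (ae_restrict_iff' measurableSet_Ioo).2 (.of_forall fun x hx => ?_)
    exact Real.rpow_nonneg (hz0.trans hx.1.le) _

lemma add_abs_sub_mem {θ φ : ℝ} (hθ : θ ∈ Ioo (0 : ℝ) π) (hφ : φ ∈ Ioo (0 : ℝ) π) :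
    sinSum θ φ ≤ θ + |θ - φ| ∧ θ + |θ - φ| ≤ 2 * π * sinSum θ φ := by
  have h1 := Real.sin_le (show 0 ≤ θ / 2 by linarith [hθ.1])
  have h2 := Real.sin_le (show 0 ≤ φ / 2 by linarith [hφ.1])
  have h3 := Real.mul_le_sin (show 0 ≤ θ / 2 by linarith [hθ.1]) (by linarith [hθ.2])
  have h4 := Real.mul_le_sin (show 0 ≤ φ / 2 by linarith [hφ.1]) (by linarith [hφ.2])
  have h5 : θ + φ ≤ π * sinSum θ φ := by
    have : (θ + φ) / π ≤ sinSum θ φ := by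
      unfold sinSum
      refine le_trans (le_of_eq ?_) (add_le_add h3 h4)
      field_simp
    rwa [div_le_iff₀ Real.pi_pos, mul_comm] at this
  unfold sinSum at *
  have := hθ.1
  have := hφ.1
  constructor
  · rcases abs_cases (θ - φ) with h | h <;> linarith
  · rcases abs_cases (θ - φ) with h | h <;> linarith

lemma density_le_of_le_half {a b : ℝ} : ∃ C, 0 < C ∧ ∀ θ ∈ Ioo (0 : ℝ) π,
    ∀ φ ∈ Ioo (0 : ℝ) π, ∀ x ∈ Ioo (0 : ℝ) π, |x - θ| < |θ - φ| → x ≤ π / 2 →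
      Real.sin (x / 2) ^ a * Real.cos (x / 2) ^ b ≤ C * (cosSum θ φ ^ b * x ^ a) := by
  refine ⟨((1 / π) ^ a + 1 ^ a) * ((1 / 4) ^ b + 4 ^ b), by positivity,
    fun θ hθ φ hφ x hx hxθ hx2 => ?_⟩
  have hpi := Real.pi_gt_three
  have hpi4 := Real.pi_le_four
  have hCo := cosSum_pos hθ hφ
  have h1 := Real.mul_le_sin (show 0 ≤ x / 2 by linarith [hx.1]) (by linarith [hx.2])
  have h2 := Real.sin_le (show 0 ≤ x / 2 by linarith [hx.1])
  have hs : Real.sin (x / 2) ^ a ≤ ((1 / π) ^ a + 1 ^ a) * x ^ a := by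
    refine rpow_le_mul_rpow a (by positivity) hx.1 (le_trans (le_of_eq ?_) h1) (by linarith [hx.1])
    field_simp
  have hcos : 1 / 2 ≤ Real.cos (x / 2) := by
    have := Real.one_sub_mul_le_cos (show 0 ≤ x / 2 by linarith [hx.1]) (by linarith [hx.2])
    refine le_trans ?_ this
    have : 2 / π * (x / 2) = x / π := by field_simp
    rw [this]
    have : x / π ≤ 1 / 2 := by rw [div_le_iff₀ Real.pi_pos]; linarith
    linarith
  have hCo4 : 1 / 4 ≤ cosSum θ φ := by
    have h := (add_abs_sub_mem (pi_sub_mem_Ioo hθ) (pi_sub_mem_Ioo hφ)).2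
    rw [sinSum_pi_sub, show π - θ - (π - φ) = -(θ - φ) by ring, abs_neg] at h
    have : θ - x ≤ |x - θ| := by rw [abs_sub_comm]; exact le_abs_self _
    nlinarith
  have hc : Real.cos (x / 2) ^ b ≤ ((1 / 4) ^ b + 4 ^ b) * cosSum θ φ ^ b :=
    rpow_le_mul_rpow b (by norm_num) hCo (by linarith [cosSum_le_two θ φ])
      (by linarith [Real.cos_le_one (x / 2)])
  have := (cos_half_pos hx).le
  have := hx.1
  calc _ ≤ (((1 / π) ^ a + 1 ^ a) * x ^ a) * (((1 / 4) ^ b + 4 ^ b) * cosSum θ φ ^ b) := by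
        gcongr
    _ = _ := by ring

lemma density_le {a b : ℝ} : ∃ C, 0 < C ∧ ∀ θ ∈ Ioo (0 : ℝ) π,
    ∀ φ ∈ Ioo (0 : ℝ) π, ∀ x ∈ Ioo (0 : ℝ) π, |x - θ| < |θ - φ| →
      Real.sin (x / 2) ^ a * Real.cos (x / 2) ^ b
        ≤ C * (cosSum θ φ ^ b * x ^ a) + C * (sinSum θ φ ^ a * (π - x) ^ b) := by
  obtain ⟨C₁, hC₁, h₁⟩ := density_le_of_le_half (a := a) (b := b)
  obtain ⟨C₂, hC₂, h₂⟩ := density_le_of_le_half (a := b) (b := a)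
  refine ⟨C₁ + C₂, by positivity, fun θ hθ φ hφ x hx hxθ => ?_⟩
  have hS := sinSum_pos hθ hφ
  have hCo := cosSum_pos hθ hφ
  have p₁ : 0 ≤ cosSum θ φ ^ b * x ^ a := by
    have := hx.1
    positivity
  have p₂ : 0 ≤ sinSum θ φ ^ a * (π - x) ^ b := by
    have := (pi_sub_mem_Ioo hx).1
    positivity
  rcases le_total x (π / 2) with h | h
  · have := h₁ θ hθ φ hφ x hx hxθ h
    nlinarith
  · have := h₂ (π - θ) (pi_sub_mem_Ioo hθ) (π - φ) (pi_sub_mem_Ioo hφ) (π - x) (pi_sub_mem_Ioo hx)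
      (by rw [show π - x - (π - θ) = -(x - θ) by ring, abs_neg,
            show π - θ - (π - φ) = -(θ - φ) by ring, abs_neg]; exact hxθ) (by linarith)
    rw [sin_half_pi_sub, cos_half_pi_sub, cosSum_pi_sub] at this
    nlinarith

lemma measurableSet_jacobiBall (θ r : ℝ) : MeasurableSet (jacobiBall θ r) :=
  measurableSet_Ioo.inter measurableSet_Ioo

lemma jacobiMeasure_jacobiBall (α β θ r : ℝ) :
    jacobiMeasure α β (jacobiBall θ r) = ∫⁻ x in jacobiBall θ r,
      ENNReal.ofReal (Real.sin (x / 2) ^ (2 * α + 1) * Real.cos (x / 2) ^ (2 * β + 1)) := by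
  rw [jacobiMeasure, withDensity_apply _ (measurableSet_jacobiBall θ r),
    Measure.restrict_restrict (measurableSet_jacobiBall θ r)]
  congr 2
  exact inter_eq_left.2 inter_subset_right

lemma jacobiMeasure_jacobiBall_pos (α β : ℝ) {θ r : ℝ} (hθ : θ ∈ Ioo (0 : ℝ) π) (hr : 0 < r) :
    0 < jacobiMeasure α β (jacobiBall θ r) := by
  rw [jacobiMeasure_jacobiBall, setLIntegral_pos_iff (by fun_prop)]
  have hsub : jacobiBall θ r ⊆ Function.support (fun x : ℝ =>
      ENNReal.ofReal (Real.sin (x / 2) ^ (2 * α + 1) * Real.cos (x / 2) ^ (2 * β + 1))) := by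
    intro x hx
    have h1 := sin_half_pos hx.2
    have h2 := cos_half_pos hx.2
    exact (ENNReal.ofReal_pos.2 (by positivity)).ne'
  rw [inter_eq_right.2 hsub]
  exact (isOpen_Ioo.inter isOpen_Ioo).measure_pos _ ⟨θ, ⟨by linarith, by linarith⟩, hθ⟩

lemma jacobiMeasure_jacobiBall_le {α β : ℝ} (hα : -1 < α) (hβ : -1 < β) :
    ∃ C, 0 < C ∧ ∀ θ ∈ Ioo (0 : ℝ) π, ∀ φ ∈ Ioo (0 : ℝ) π, θ ≠ φ →
      jacobiMeasure α β (jacobiBall θ |θ - φ|) ≤ ENNReal.ofReal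
        (C * (|θ - φ| * sinSum θ φ ^ (2 * α + 1) * cosSum θ φ ^ (2 * β + 1))) := by
  set a := 2 * α + 1 with ha
  set b := 2 * β + 1 with hb
  obtain ⟨C, hC, h⟩ := density_le (a := a) (b := b)
  obtain ⟨Ca, hCa, hIa⟩ := setLIntegral_rpow_le (a := a) (by linarith)
  obtain ⟨Cb, hCb, hIb⟩ := setLIntegral_rpow_le (a := b) (by linarith)
  refine ⟨C * Ca * (1 ^ a + (2 * π) ^ a) + C * Cb * (1 ^ b + (2 * π) ^ b), by positivity,
    fun θ hθ φ hφ hne => ?_⟩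
  set r := |θ - φ| with hr
  have hr0 : 0 < r := abs_pos.2 (sub_ne_zero.2 hne)
  have hS := sinSum_pos hθ hφ
  have hCo := cosSum_pos hθ hφ
  have hθ' := pi_sub_mem_Ioo hθ
  obtain ⟨s1, s2⟩ := add_abs_sub_mem hθ hφ
  obtain ⟨c1, c2⟩ := add_abs_sub_mem hθ' (pi_sub_mem_Ioo hφ)
  rw [sinSum_pi_sub, show π - θ - (π - φ) = -(θ - φ) by ring, abs_neg] at c1 c2
  rw [← hr] at s1 s2 c1 c2
  have ka : (θ + r) ^ a ≤ (1 ^ a + (2 * π) ^ a) * sinSum θ φ ^ a :=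
    rpow_le_mul_rpow a one_pos hS (by linarith) s2
  have kb : (π - θ + r) ^ b ≤ (1 ^ b + (2 * π) ^ b) * cosSum θ φ ^ b :=
    rpow_le_mul_rpow b one_pos hCo (by linarith) c2
  have ia : ∫⁻ x in jacobiBall θ r, ENNReal.ofReal (x ^ a)
      ≤ ENNReal.ofReal (Ca * r * (θ + r) ^ a) :=
    (lintegral_mono_set (inter_subset_inter_right _ fun x hx => hx.1)).trans (hIa θ r hθ.1 hr0)
  have ib : ∫⁻ x in jacobiBall θ r, ENNReal.ofReal ((π - x) ^ b)
      ≤ ENNReal.ofReal (Cb * r * (π - θ + r) ^ b) := by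
    refine le_trans ?_ (hIb (π - θ) r hθ'.1 hr0)
    have hm : MeasurableSet (Ioo (π - θ - r) (π - θ + r) ∩ Ioi 0) :=
      measurableSet_Ioo.inter measurableSet_Ioi
    rw [← lintegral_indicator hm, ← lintegral_indicator (measurableSet_jacobiBall θ r),
      ← lintegral_sub_left_eq_self _ π]
    refine lintegral_mono fun x => ?_
    by_cases hx : π - x ∈ jacobiBall θ r
    · have hx' : x ∈ Ioo (π - θ - r) (π - θ + r) ∩ Ioi 0 :=
        ⟨⟨by linarith [hx.1.2], by linarith [hx.1.1]⟩, by simpa using hx.2.2⟩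
      rw [indicator_of_mem hx, indicator_of_mem hx', sub_sub_cancel]
    · rw [indicator_of_notMem hx]
      exact zero_le
  have hball : ∀ x ∈ jacobiBall θ r, |x - θ| < r := fun x hx =>
    abs_lt.2 ⟨by linarith [hx.1.1], by linarith [hx.1.2]⟩
  calc jacobiMeasure α β (jacobiBall θ r)
      ≤ ∫⁻ x in jacobiBall θ r, (ENNReal.ofReal (C * cosSum θ φ ^ b) * ENNReal.ofReal (x ^ a)
          + ENNReal.ofReal (C * sinSum θ φ ^ a) * ENNReal.ofReal ((π - x) ^ b)) := by
        rw [jacobiMeasure_jacobiBall]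
        refine setLIntegral_mono' (measurableSet_jacobiBall θ r) fun x hx => ?_
        have hx1 := hx.2.1
        have hx2 := (pi_sub_mem_Ioo hx.2).1
        rw [← ENNReal.ofReal_mul (by positivity), ← ENNReal.ofReal_mul (by positivity),
          ← ENNReal.ofReal_add (by positivity) (by positivity)]
        refine ENNReal.ofReal_le_ofReal ((h θ hθ φ hφ x hx.2 (hball x hx)).trans_eq ?_)
        ring
    _ = ENNReal.ofReal (C * cosSum θ φ ^ b) * (∫⁻ x in jacobiBall θ r, ENNReal.ofReal (x ^ a))
          + ENNReal.ofReal (C * sinSum θ φ ^ a) *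
            ∫⁻ x in jacobiBall θ r, ENNReal.ofReal ((π - x) ^ b) := by
        rw [lintegral_add_left (by fun_prop), lintegral_const_mul _ (by fun_prop),
          lintegral_const_mul _ (by fun_prop)]
    _ ≤ ENNReal.ofReal (C * cosSum θ φ ^ b) * ENNReal.ofReal (Ca * r * (θ + r) ^ a)
          + ENNReal.ofReal (C * sinSum θ φ ^ a) * ENNReal.ofReal (Cb * r * (π - θ + r) ^ b) := by
        gcongr
    _ = ENNReal.ofReal (C * cosSum θ φ ^ b * (Ca * r * (θ + r) ^ a)
          + C * sinSum θ φ ^ a * (Cb * r * (π - θ + r) ^ b)) := by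
        have := hθ.1
        have := hθ'.1
        rw [← ENNReal.ofReal_mul (by positivity), ← ENNReal.ofReal_mul (by positivity),
          ← ENNReal.ofReal_add (by positivity) (by positivity)]
    _ ≤ _ := by
        apply ENNReal.ofReal_le_ofReal
        calc _ ≤ C * cosSum θ φ ^ b * (Ca * r * ((1 ^ a + (2 * π) ^ a) * sinSum θ φ ^ a))
              + C * sinSum θ φ ^ a * (Cb * r * ((1 ^ b + (2 * π) ^ b) * cosSum θ φ ^ b)) := by
              gcongr
          _ = _ := by ring

lemma ballScale_le {α β s : ℝ} (hα : -1 < α) (hβ : -1 < β) (hs : 0 ≤ s) :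
    ∃ C, 0 < C ∧ ∀ θ ∈ Ioo (0 : ℝ) π, ∀ φ ∈ Ioo (0 : ℝ) π, θ ≠ φ →
      ballScale α β s θ φ
        ≤ C * |θ - φ| ^ (-s) / (jacobiMeasure α β (jacobiBall θ |θ - φ|)).toReal := by
  obtain ⟨C, hC, h⟩ := jacobiMeasure_jacobiBall_le hα hβ
  refine ⟨(1 / (2 * π ^ 2)) ^ (-((1 + s) / 2)) * C, by positivity, fun θ hθ φ hφ hne => ?_⟩
  have hμ := h θ hθ φ hφ hne
  have hr : 0 < |θ - φ| := abs_pos.2 (sub_ne_zero.2 hne)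
  have hS := sinSum_pos hθ hφ
  have hCo := cosSum_pos hθ hφ
  have hpos := jacobiMeasure_jacobiBall_pos α β hθ hr
  rw [le_div_iff₀ (ENNReal.toReal_pos hpos.ne' (hμ.trans_lt ENNReal.ofReal_lt_top).ne)]
  have hμ' := ENNReal.toReal_le_of_le_ofReal (by positivity) hμ
  have hA : qMin θ φ ^ (-((1 + s) / 2))
      ≤ (1 / (2 * π ^ 2)) ^ (-((1 + s) / 2)) * |θ - φ| ^ (-(1 + s)) := by
    refine (Real.rpow_le_rpow_of_nonpos (by positivity) (sq_sub_le_qMin hθ hφ)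
      (by linarith)).trans_eq ?_
    rw [Real.mul_rpow (by positivity) (by positivity), ← Real.rpow_natCast |θ - φ|,
      ← Real.rpow_mul hr.le]
    congr 2; push_cast; ring
  have hG := (ballScale_pos (α := α) (β := β) (s := s) hθ hφ hne).le
  have c1 : ∀ S e : ℝ, 0 < S → S ^ (-e) * S ^ e = 1 := fun S e hS => by
    rw [← Real.rpow_add hS]; simp
  have c2 : |θ - φ| ^ (-(1 + s)) * |θ - φ| = |θ - φ| ^ (-s) := by
    rw [← Real.rpow_add_one hr.ne']; congr 1; ring
  calc _ ≤ ballScale α β s θ φ *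
        (C * (|θ - φ| * sinSum θ φ ^ (2 * α + 1) * cosSum θ φ ^ (2 * β + 1))) := by gcongr
    _ = C * qMin θ φ ^ (-((1 + s) / 2)) * |θ - φ| *
        (sinSum θ φ ^ (-(2 * α + 1)) * sinSum θ φ ^ (2 * α + 1)) *
        (cosSum θ φ ^ (-(2 * β + 1)) * cosSum θ φ ^ (2 * β + 1)) := by
        rw [ballScale]; ring
    _ = C * qMin θ φ ^ (-((1 + s) / 2)) * |θ - φ| := by
        rw [c1 _ _ hS, c1 _ _ hCo]; ring
    _ ≤ C * ((1 / (2 * π ^ 2)) ^ (-((1 + s) / 2)) * |θ - φ| ^ (-(1 + s))) * |θ - φ| := by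
        gcongr
    _ = _ := by rw [← c2]; ring

theorem stmt_5 (α β W s : ℝ) (hα : -1 < α) (hβ : -1 < β) (hW : 1 ≤ W) (hs : 0 ≤ s) :
    ∃ C : ℝ, 0 < C ∧
      ∀ θ ∈ Ioo (0 : ℝ) π, ∀ φ ∈ Ioo (0 : ℝ) π, θ ≠ φ →
        (∫ t in Ioo (0 : ℝ) π, (Ups α β W s t θ φ) ^ 2 * t ^ (W - 1)) ^ ((1 : ℝ) / 2)
          ≤ C * |θ - φ| ^ (-s) / (jacobiMeasure α β (jacobiBall θ |θ - φ|)).toReal := by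
  obtain ⟨C₁, hC₁, h₁⟩ := (controlled_Ups hα hβ hW hs).sqrt_integral_le hW
  obtain ⟨C₂, hC₂, h₂⟩ := ballScale_le hα hβ hs
  refine ⟨(C₁ + 1) * C₂, by positivity, fun θ hθ φ hφ hne => ?_⟩
  have hG := (ballScale_pos (α := α) (β := β) (s := s) hθ hφ hne).le
  calc _ ≤ C₁ * ballScale α β s θ φ := h₁ θ hθ φ hφ hne
    _ ≤ (C₁ + 1) * ballScale α β s θ φ := by gcongr; linarith
    _ ≤ (C₁ + 1) * _ := mul_le_mul_of_nonneg_left (h₂ θ hθ φ hφ hne) (by positivity)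
    _ = _ := by ring
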